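/- arXiv:1910.05452 — 2 statements merged into one kernel-verified Lean document; each statement's English description precedes it below -/
import Mathlib

section
/- Let (X, Y) be a bivariate normal pair with means μ_X, μ_Y, standard deviations σ_X, σ_Y > 0 and correlation ρ ∈ [−1, 1], and let c ∈ ℝ with z_c = (c − μ_X)/σ_X. Then the conditional variance of Y given the event {X ≥ c} satisfies Var[Y | X ≥ c] = σ_Y² · (1 + ρ²·z_c·φ(z_c)/(1 − Φ(z_c)) − ρ²·(φ(z_c)/(1 − Φ(z_c)))²). -/
open MeasureTheory ProbabilityTheory Real

/-- The standard normal density. -/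
noncomputable def normPDF (t : ℝ) : ℝ := Real.exp (-t ^ 2 / 2) / Real.sqrt (2 * Real.pi)

/-- The standard normal cumulative distribution function. -/
noncomputable def normCDF (t : ℝ) : ℝ := ∫ s in Set.Iic t, normPDF s

lemma normPDF_eq_gaussianPDFReal : normPDF = gaussianPDFReal 0 1 := by
  ext t
  simp [normPDF, gaussianPDFReal, div_eq_inv_mul]

lemma hasDerivAt_normPDF (x : ℝ) : HasDerivAt normPDF (-(x * normPDF x)) x := by
  have h : HasDerivAt (fun t : ℝ => -t ^ 2 / 2) (-x) x := by
    convert! ((hasDerivAt_pow 2 x).neg.div_const 2) using 1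
    simp
    ring
  convert! (h.exp.div_const (√(2 * π))) using 1
  simp only [normPDF]
  ring

lemma integrable_pow_gaussianReal (μ : ℝ) (v : NNReal) (n : ℕ) :
    Integrable (fun x : ℝ => x ^ n) (gaussianReal μ v) := by
  have h := (memLp_id_gaussianReal (μ := μ) (v := v) (n : NNReal)).integrable_norm_pow'
  refine (integrable_norm_iff (by fun_prop)).1 ?_
  simpa [norm_pow] using h

lemma integrable_pow_mul_normPDF (n : ℕ) : Integrable fun x : ℝ => x ^ n * normPDF x := by
  have h := integrable_pow_gaussianReal 0 1 n
  rw [gaussianReal_of_var_ne_zero _ one_ne_zero, integrable_withDensity_iff_integrable_smul'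
    (measurable_gaussianPDF _ _) (ae_of_all _ fun _ => gaussianPDF_lt_top)] at h
  simpa [normPDF_eq_gaussianPDFReal, toReal_gaussianPDF, mul_comm] using h

lemma setIntegral_Ici_gaussianReal (f : ℝ → ℝ) (z : ℝ) :
    ∫ x in Set.Ici z, f x ∂gaussianReal 0 1 = ∫ x in Set.Ioi z, f x * normPDF x := by
  rw [← integral_indicator measurableSet_Ici, integral_gaussianReal_eq_integral_smul one_ne_zero,
    ← integral_Ici_eq_integral_Ioi, ← integral_indicator measurableSet_Ici]
  congr with x
  by_cases hx : x ∈ Set.Ici z <;> simp [hx, normPDF_eq_gaussianPDFReal, mul_comm]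

lemma gaussianReal_real_Ici (z : ℝ) : (gaussianReal 0 1).real (Set.Ici z) = 1 - normCDF z := by
  have h := setIntegral_Ici_gaussianReal (fun _ => 1) z
  have hi : Integrable normPDF := by simpa using integrable_pow_mul_normPDF 0
  have h1 : ∫ x, normPDF x = 1 := by
    rw [normPDF_eq_gaussianPDFReal, integral_gaussianPDFReal_eq_one _ one_ne_zero]
  have h2 := intervalIntegral.integral_Iic_add_Ioi (b := z) hi.integrableOn hi.integrableOn
  simp at h
  rw [h, normCDF]
  linarith

lemma setIntegral_Ici_id_gaussianReal (z : ℝ) :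
    ∫ x in Set.Ici z, x ∂gaussianReal 0 1 = normPDF z := by
  have hd (x : ℝ) : HasDerivAt (fun t => -normPDF t) (x * normPDF x) x := by
    convert! (hasDerivAt_normPDF x).neg using 1
    ring
  have hi : Integrable fun x => x * normPDF x := by simpa using integrable_pow_mul_normPDF 1
  have hi' : Integrable fun x => -normPDF x := by simpa using (integrable_pow_mul_normPDF 0).neg
  rw [setIntegral_Ici_gaussianReal, integral_Ioi_of_hasDerivAt_of_tendsto' (fun x _ => hd x)
    hi.integrableOn (tendsto_zero_of_hasDerivAt_of_integrableOn_Ioi (a := z) (fun x _ => hd x)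
      hi.integrableOn hi'.integrableOn)]
  ring

lemma setIntegral_Ici_sq_gaussianReal (z : ℝ) :
    ∫ x in Set.Ici z, x ^ 2 ∂gaussianReal 0 1 = 1 - normCDF z + z * normPDF z := by
  have hd (x : ℝ) :
      HasDerivAt (fun t => -(t * normPDF t)) (x ^ 2 * normPDF x - normPDF x) x := by
    convert! ((hasDerivAt_id x).mul (hasDerivAt_normPDF x)).neg using 1
    simp
    ring
  have hi : Integrable fun x => x ^ 2 * normPDF x := integrable_pow_mul_normPDF 2
  have h0 : Integrable normPDF := by simpa using integrable_pow_mul_normPDF 0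
  have h1 : Integrable fun x => -(x * normPDF x) := by
    simpa using (integrable_pow_mul_normPDF 1).neg
  have hs := integral_Ioi_of_hasDerivAt_of_tendsto' (a := z) (fun x _ => hd x)
    (hi.sub h0).integrableOn (tendsto_zero_of_hasDerivAt_of_integrableOn_Ioi (a := z)
      (fun x _ => hd x) (hi.sub h0).integrableOn h1.integrableOn)
  rw [integral_sub hi.integrableOn h0.integrableOn] at hs
  have hQ := setIntegral_Ici_gaussianReal (fun _ => 1) z
  simp [gaussianReal_real_Ici] at hQ
  rw [setIntegral_Ici_gaussianReal, hQ]
  linarith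

lemma gaussianReal_real_Ici_pos (z : ℝ) : 0 < (gaussianReal 0 1).real (Set.Ici z) := by
  refine ENNReal.toReal_pos (fun h => ?_) (measure_ne_top _ _)
  simpa using gaussianReal_absolutelyContinuous' 0 one_ne_zero h

/-- Restricting to an event determined by `Z` leaves `ε`, independent of `Z`, unaffected. -/
lemma setIntegral_preimage_mul_of_indepFun {Ω : Type*} [MeasurableSpace Ω] {P : Measure Ω}
    {Z ε : Ω → ℝ} (hZ : Measurable Z) (hε : Measurable ε) (hind : IndepFun Z ε P)
    {f g : ℝ → ℝ} (hf : Measurable f) (hg : Measurable g) {s : Set ℝ} (hs : MeasurableSet s) :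
    ∫ ω in Z ⁻¹' s, f (Z ω) * g (ε ω) ∂P = (∫ ω in Z ⁻¹' s, f (Z ω) ∂P) * ∫ ω, g (ε ω) ∂P := by
  have hfs : Measurable (s.indicator f) := hf.indicator hs
  have h := (hind.comp hfs hg).integral_fun_mul_eq_mul_integral
    (hfs.comp hZ).aestronglyMeasurable (hg.comp hε).aestronglyMeasurable
  rw [← integral_indicator (hZ hs), ← integral_indicator (hZ hs)]
  convert! h using 2
  ext ω
  by_cases hω : Z ω ∈ s <;> simp [hω]

lemma condVar_right_tail_add_indep {Ω : Type*} [MeasurableSpace Ω] {P : Measure Ω}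
    [IsProbabilityMeasure P] {Z ε : Ω → ℝ} (hZm : Measurable Z) (hεm : Measurable ε)
    {v : NNReal} (hZ : P.map Z = gaussianReal 0 1) (hε : P.map ε = gaussianReal 0 v)
    (hind : IndepFun Z ε P) (a b z : ℝ) :
    (∫ ω in Z ⁻¹' Set.Ici z, (a + b * Z ω + ε ω) ^ 2 ∂P) / P.real (Z ⁻¹' Set.Ici z)
      - ((∫ ω in Z ⁻¹' Set.Ici z, (a + b * Z ω + ε ω) ∂P) / P.real (Z ⁻¹' Set.Ici z)) ^ 2
      = v + b ^ 2 * (1 + z * (normPDF z / (1 - normCDF z))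
          - (normPDF z / (1 - normCDF z)) ^ 2) := by
  have hs : MeasurableSet (Set.Ici z) := measurableSet_Ici
  have hP : P.real (Z ⁻¹' Set.Ici z) = 1 - normCDF z := by
    rw [← gaussianReal_real_Ici, ← hZ, map_measureReal_apply hZm hs]
  have hpos : 0 < 1 - normCDF z := gaussianReal_real_Ici z ▸ gaussianReal_real_Ici_pos z
  have hZ1 : ∫ ω in Z ⁻¹' Set.Ici z, Z ω ∂P = normPDF z := by
    rw [← setIntegral_Ici_id_gaussianReal, ← hZ,
      setIntegral_map hs (by fun_prop) hZm.aemeasurable]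
  have hZ2 : ∫ ω in Z ⁻¹' Set.Ici z, Z ω ^ 2 ∂P = 1 - normCDF z + z * normPDF z := by
    rw [← setIntegral_Ici_sq_gaussianReal, ← hZ,
      setIntegral_map hs (by fun_prop) hZm.aemeasurable]
  have hε1 : ∫ ω, ε ω ∂P = 0 := by
    rw [← integral_map (f := fun x => x) hεm.aemeasurable (by fun_prop), hε,
      integral_id_gaussianReal]
  have hε2 : ∫ ω, ε ω ^ 2 ∂P = v := by
    have h := variance_fun_id_gaussianReal (μ := 0) (v := v)
    rw [variance_of_integral_eq_zero (by fun_prop) integral_id_gaussianReal] at h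
    rw [← integral_map (f := fun x => x ^ 2) hεm.aemeasurable (by fun_prop), hε, h]
  have iZ (n : ℕ) : Integrable (fun ω => Z ω ^ n) P :=
    (hZ ▸ integrable_pow_gaussianReal 0 1 n).comp_measurable hZm
  have iε (n : ℕ) : Integrable (fun ω => ε ω ^ n) P :=
    (hε ▸ integrable_pow_gaussianReal 0 v n).comp_measurable hεm
  have iZ1 : Integrable Z P := by simpa using iZ 1
  have iε1 : Integrable ε P := by simpa using iε 1
  have iZε : Integrable (fun ω => Z ω * ε ω) P := hind.integrable_mul iZ1 iε1
  have jε1 : ∫ ω in Z ⁻¹' Set.Ici z, ε ω ∂P = 0 := by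
    simpa [hε1] using setIntegral_preimage_mul_of_indepFun hZm hεm hind
      (f := fun _ => 1) (g := fun x => x) (by fun_prop) (by fun_prop) hs
  have jε2 : ∫ ω in Z ⁻¹' Set.Ici z, ε ω ^ 2 ∂P = (1 - normCDF z) * v := by
    rw [← hε2]
    simpa [hP] using setIntegral_preimage_mul_of_indepFun hZm hεm hind
      (f := fun _ => 1) (g := fun x => x ^ 2) (by fun_prop) (by fun_prop) hs
  have jZε : ∫ ω in Z ⁻¹' Set.Ici z, Z ω * ε ω ∂P = 0 := by
    simpa [hε1] using setIntegral_preimage_mul_of_indepFun hZm hεm hind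
      (f := fun x => x) (g := fun x => x) (by fun_prop) (by fun_prop) hs
  have hfirst : ∫ ω in Z ⁻¹' Set.Ici z, (a + b * Z ω + ε ω) ∂P
      = a * (1 - normCDF z) + b * normPDF z := by
    have i1 := (integrable_const a).integrableOn (s := Z ⁻¹' Set.Ici z) (μ := P)
    have i2 := (iZ1.const_mul b).integrableOn (s := Z ⁻¹' Set.Ici z)
    rw [integral_add ?_ iε1.integrableOn, integral_add i1 i2, integral_const_mul, hZ1, jε1]
    · simp [hP, mul_comm]
    · exact i1.add i2
  have hsecond : ∫ ω in Z ⁻¹' Set.Ici z, (a + b * Z ω + ε ω) ^ 2 ∂P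
      = (∫ ω in Z ⁻¹' Set.Ici z, (a ^ 2 + (2 * a * b) * Z ω + b ^ 2 * Z ω ^ 2
        + (2 * a) * ε ω + (2 * b) * (Z ω * ε ω) + ε ω ^ 2) ∂P) := by
    congr with ω
    ring
  have i1 := (iZ1.const_mul (2 * a * b)).integrableOn (s := Z ⁻¹' Set.Ici z)
  have i2 := ((iZ 2).const_mul (b ^ 2)).integrableOn (s := Z ⁻¹' Set.Ici z)
  have i3 := (iε1.const_mul (2 * a)).integrableOn (s := Z ⁻¹' Set.Ici z)
  have i4 := (iZε.const_mul (2 * b)).integrableOn (s := Z ⁻¹' Set.Ici z)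
  have i5 := (iε 2).integrableOn (s := Z ⁻¹' Set.Ici z)
  have i0 : IntegrableOn (fun _ : Ω => a ^ 2) (Z ⁻¹' Set.Ici z) P :=
    (integrable_const _).integrableOn
  have k2 := Integrable.fun_add i0 i1
  have k3 := k2.fun_add i2
  have k4 := k3.fun_add i3
  have k5 := k4.fun_add i4
  rw [integral_add k5 i5, integral_add k4 i4, integral_add k3 i3, integral_add k2 i2,
    integral_add i0 i1] at hsecond
  simp only [integral_const_mul, hZ1, hZ2, jε1, jε2, jZε, integral_const, smul_eq_mul,
    measureReal_restrict_apply_univ, hP] at hsecond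
  rw [hfirst, hsecond, hP]
  field_simp
  ring

/-- For a bivariate normal pair `(X, Y)`, the conditional variance of `Y` given `{X ≥ c}` is
`σY² · (1 + ρ²·z_c·φ(z_c)/(1 − Φ(z_c)) − ρ²·(φ(z_c)/(1 − Φ(z_c)))²)`. -/
theorem bivariate_condVar_right_tail
    {Ω : Type*} [MeasurableSpace Ω] (P : Measure Ω) [IsProbabilityMeasure P]
    (X ε Y : Ω → ℝ) (hXm : Measurable X) (hεm : Measurable ε)
    (μX μY σX σY ρ c : ℝ) (hσX : 0 < σX) (hσY : 0 < σY) (hρ : ρ ∈ Set.Icc (-1 : ℝ) 1)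
    (hX : Measure.map X P = gaussianReal μX (Real.toNNReal (σX ^ 2)))
    (hε : Measure.map ε P = gaussianReal 0 (Real.toNNReal ((1 - ρ ^ 2) * σY ^ 2)))
    (hind : IndepFun X ε P)
    (hY : ∀ ω, Y ω = μY + ρ * (σY / σX) * (X ω - μX) + ε ω) :
    (∫ ω in {ω | X ω ≥ c}, (Y ω) ^ 2 ∂P) / (P {ω | X ω ≥ c}).toReal
      - ((∫ ω in {ω | X ω ≥ c}, Y ω ∂P) / (P {ω | X ω ≥ c}).toReal) ^ 2
      = σY ^ 2 * (1 + ρ ^ 2 * ((c - μX) / σX)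
            * (normPDF ((c - μX) / σX) / (1 - normCDF ((c - μX) / σX)))
          - ρ ^ 2 * (normPDF ((c - μX) / σX) / (1 - normCDF ((c - μX) / σX))) ^ 2) := by
  set z := (c - μX) / σX with hz
  let Z : Ω → ℝ := fun ω => (X ω - μX) / σX
  have hZm : Measurable Z := by fun_prop
  have hZ : P.map Z = gaussianReal 0 1 := by
    have h := gaussianReal_div_const
      (gaussianReal_sub_const (P := P) ⟨hXm.aemeasurable, hX⟩ μX) σX
    convert! h.map_eq using 2
    · simp
    · ext
      simp [hσX.ne', sq_nonneg]
  have hindZ : IndepFun Z ε P :=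
    hind.comp (φ := fun x => (x - μX) / σX) (ψ := id) (by fun_prop) measurable_id
  have hset : {ω | X ω ≥ c} = Z ⁻¹' Set.Ici z := by
    ext ω
    simp [Z, z, div_le_div_iff_of_pos_right hσX]
  have hY' (ω : Ω) : Y ω = μY + ρ * σY * Z ω + ε ω := by
    rw [hY ω]
    simp only [Z]
    ring
  have hv : 0 ≤ (1 - ρ ^ 2) * σY ^ 2 :=
    mul_nonneg (by nlinarith [hρ.1, hρ.2]) (sq_nonneg _)
  have h := condVar_right_tail_add_indep hZm hεm hZ hε hindZ μY (ρ * σY) z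
  rw [Real.coe_toNNReal _ hv] at h
  simp only [hset, hY', ← measureReal_def]
  rw [h]
  ring
end

section
/- For all a, b > 0 and x, y ∈ ℝ, the integral G([a,x],[b,y]) = ∫_0^1 exp(−a(x − z)²)·exp(−b(y − z)²) dz has the closed form G([a,x],[b,y]) = √(π/(a+b)) · exp((ax + by)²/(a+b) − a·x² − b·y²) · [Φ(√(2/(a+b))·(a + b − ax − by)) − Φ(−√(2/(a+b))·(ax + by))]. -/
open MeasureTheory Real

theorem integrable_normPDF : Integrable normPDF := by
  refine ((integrable_exp_neg_mul_sq (b := 1 / 2) (by norm_num)).div_const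
    (Real.sqrt (2 * Real.pi))).congr (Filter.Eventually.of_forall fun t => ?_)
  simp only [normPDF]
  congr 2
  ring

theorem normCDF_sub_normCDF (s t : ℝ) : normCDF t - normCDF s = ∫ u in s..t, normPDF u :=
  intervalIntegral.integral_Iic_sub_Iic integrable_normPDF.integrableOn
    integrable_normPDF.integrableOn

theorem exp_mul_exp_eq_normPDF {a b : ℝ} (hab : 0 < a + b) (x y z : ℝ) :
    Real.exp (-a * (x - z) ^ 2) * Real.exp (-b * (y - z) ^ 2)
      = Real.sqrt (2 * Real.pi)
        * Real.exp ((a * x + b * y) ^ 2 / (a + b) - a * x ^ 2 - b * y ^ 2)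
        * normPDF (Real.sqrt (2 / (a + b)) * (a + b) * z
            - Real.sqrt (2 / (a + b)) * (a * x + b * y)) := by
  have hr : Real.sqrt (2 / (a + b)) ^ 2 = 2 / (a + b) := Real.sq_sqrt (by positivity)
  have hpi : Real.sqrt (2 * Real.pi) ≠ 0 := by positivity
  have hexp : -a * (x - z) ^ 2 + -b * (y - z) ^ 2
      = ((a * x + b * y) ^ 2 / (a + b) - a * x ^ 2 - b * y ^ 2)
        + -(Real.sqrt (2 / (a + b)) * (a + b) * z
            - Real.sqrt (2 / (a + b)) * (a * x + b * y)) ^ 2 / 2 := by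
    rw [mul_assoc, ← mul_sub, mul_pow, hr]
    field_simp
    ring
  rw [← Real.exp_add, hexp, Real.exp_add, normPDF]
  field_simp

theorem sqrt_pi_div_mul_sqrt_two_div_mul {s : ℝ} (hs : 0 < s) :
    Real.sqrt (Real.pi / s) * (Real.sqrt (2 / s) * s) = Real.sqrt (2 * Real.pi) := by
  rw [← mul_assoc, ← Real.sqrt_mul (by positivity)]
  have h : Real.pi / s * (2 / s) = 2 * Real.pi / s ^ 2 := by field_simp
  rw [h, Real.sqrt_div (by positivity), Real.sqrt_sq hs.le]
  field_simp

/-- Closed form for the Gaussian-product integral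
`G([a,x],[b,y]) = ∫_0^1 exp(−a(x−z)²)·exp(−b(y−z)²) dz`. -/
theorem gaussian_product_integral_closed_form (a b x y : ℝ) (ha : 0 < a) (hb : 0 < b) :
    (∫ z in (0 : ℝ)..1, Real.exp (-a * (x - z) ^ 2) * Real.exp (-b * (y - z) ^ 2))
      = Real.sqrt (Real.pi / (a + b))
        * Real.exp ((a * x + b * y) ^ 2 / (a + b) - a * x ^ 2 - b * y ^ 2)
        * (normCDF (Real.sqrt (2 / (a + b)) * (a + b - a * x - b * y))
            - normCDF (-(Real.sqrt (2 / (a + b)) * (a * x + b * y)))) := by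
  have hab : 0 < a + b := add_pos ha hb
  have hcdf := intervalIntegral.mul_integral_comp_mul_sub (a := 0) (b := 1) (f := normPDF)
    (Real.sqrt (2 / (a + b)) * (a + b)) (Real.sqrt (2 / (a + b)) * (a * x + b * y))
  rw [normCDF_sub_normCDF]
  simp_rw [exp_mul_exp_eq_normPDF hab x y]
  rw [intervalIntegral.integral_const_mul, ← sqrt_pi_div_mul_sqrt_two_div_mul hab]
  convert congrArg (Real.sqrt (Real.pi / (a + b))
    * Real.exp ((a * x + b * y) ^ 2 / (a + b) - a * x ^ 2 - b * y ^ 2) * ·) hcdf using 1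
  · ring
  · congr 2 <;> ring
end
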